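/- arXiv:1502.07277 — 11 statements merged into one kernel-verified Lean document; each statement's English description precedes it below -/
import Mathlib

section
/- Let 𝕋 be a time scale, f : 𝕋 → ℝ, t ∈ 𝕋_κ, and α ∈ ]0,1] with α = 1/q for some odd natural number q. If t is left-dense and f is nabla fractional differentiable of order α at t, then f is continuous at t (with respect to the subspace topology of 𝕋): for every ε > 0 there exists δ > 0 such that |f(s) − f(t)| ≤ ε for all s ∈ 𝕋 with |s − t| < δ. -/
open Set Filter Topology
open scoped Classical

/-- Backward jump operator ρ on a time scale `T`:
`ρ(t) = sup {s ∈ T | s < t}`, with `ρ(t) = t` when this set is empty. -/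
noncomputable def TS.rho (T : Set ℝ) (t : ℝ) : ℝ :=
  if ({s | s ∈ T ∧ s < t}).Nonempty then sSup {s | s ∈ T ∧ s < t} else t

/-- Forward jump operator σ on a time scale `T`:
`σ(t) = inf {s ∈ T | s > t}`, with `σ(t) = t` when this set is empty. -/
noncomputable def TS.sigma (T : Set ℝ) (t : ℝ) : ℝ :=
  if ({s | s ∈ T ∧ t < s}).Nonempty then sInf {s | s ∈ T ∧ t < s} else t

/-- `𝕋_κ`: remove the minimum of `T` when it exists and is right-scattered. -/
def TS.kappaLow (T : Set ℝ) : Set ℝ :=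
  T \ {m | IsLeast T m ∧ m < TS.sigma T m}

/-- `𝕋^κ`: remove the maximum of `T` when it exists and is left-scattered. -/
def TS.kappaHigh (T : Set ℝ) : Set ℝ :=
  T \ {M | IsGreatest T M ∧ TS.rho T M < M}

/-- Signed real power: `x^α = sign(x) * |x|^α`.  For `x ≥ 0` this is the usual
real power; for `x < 0` it is `-(-x)^α` (in particular, for `α = 1/q` with `q`
odd, the real `q`-th root). -/
noncomputable def TS.fpow (x α : ℝ) : ℝ := Real.sign x * |x| ^ α

/-- `α` is of the form `1/q` for some odd natural number `q`. -/
def TS.OddRecip (α : ℝ) : Prop := ∃ q : ℕ, Odd q ∧ α = 1 / (q : ℝ)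

/-- `L` is the nabla fractional derivative of `f` of order `α` at `t` on the
time scale `T`.  If `α = 1/q` with `q` odd, a full `δ`-neighborhood of `t` in
`T` is used; otherwise only the right `δ`-neighborhood `[t, t+δ[ ∩ T`. -/
def TS.HasNablaFracDerivAt (T : Set ℝ) (f : ℝ → ℝ) (α t L : ℝ) : Prop :=
  (TS.OddRecip α → ∀ ε > (0:ℝ), ∃ δ > (0:ℝ), ∀ s ∈ T, |s - t| < δ →
      |(f s - f (TS.rho T t)) - L * TS.fpow (s - TS.rho T t) α|
        ≤ ε * |s - TS.rho T t| ^ α) ∧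
  (¬ TS.OddRecip α → ∀ ε > (0:ℝ), ∃ δ > (0:ℝ), ∀ s ∈ T, t ≤ s → s < t + δ →
      |(f s - f (TS.rho T t)) - L * TS.fpow (s - TS.rho T t) α|
        ≤ ε * |s - TS.rho T t| ^ α)

/-- `L` is a symmetric fractional derivative of `f` of order `α` at `t` on the
time scale `T`. -/
def TS.HasSymFracDerivAt (T : Set ℝ) (f : ℝ → ℝ) (α t L : ℝ) : Prop :=
  ∀ ε > (0:ℝ), ∃ δ > (0:ℝ), ∀ s ∈ T, |s - t| < δ →
    2 * t - s ∈ T → |(2 * t - s) - t| < δ →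
      |(f (TS.sigma T t) - f s + f (2 * t - s) - f (TS.rho T t))
          - L * TS.fpow (TS.sigma T t + 2 * t - 2 * s - TS.rho T t) α|
        ≤ ε * |TS.sigma T t + 2 * t - 2 * s - TS.rho T t| ^ α

/-- If `α = 1/q` with `q` odd, `t ∈ 𝕋_κ` is left-dense, and `f` is nabla
fractional differentiable of order `α` at `t`, then `f` is continuous at `t`
(in the subspace topology of `𝕋`). -/
theorem stmt0 (T : Set ℝ) (hTne : T.Nonempty) (hTcl : IsClosed T)
    (f : ℝ → ℝ) (t : ℝ) (ht : t ∈ TS.kappaLow T)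
    (α : ℝ) (hα : α ∈ Set.Ioc (0:ℝ) 1) (hodd : TS.OddRecip α)
    (hld : TS.rho T t = t)
    (L : ℝ) (hL : TS.HasNablaFracDerivAt T f α t L) :
    ∀ ε > (0:ℝ), ∃ δ > (0:ℝ), ∀ s ∈ T, |s - t| < δ → |f s - f t| ≤ ε := by
  intro ε hε
  obtain ⟨δ, hδ, h⟩ := hL.1 hodd 1 one_pos
  have hC : 0 < 1 + |L| := by positivity
  have hq : 0 < ε / (1 + |L|) := by positivity
  refine ⟨min δ ((ε / (1 + |L|)) ^ (1 / α)), lt_min hδ (Real.rpow_pos_of_pos hq _), ?_⟩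
  intro s hs hst
  have h1 := h s hs (lt_of_lt_of_le hst (min_le_left _ _))
  rw [hld, one_mul] at h1
  have h2 : |s - t| ^ α ≤ ε / (1 + |L|) := by
    have h3 := Real.rpow_le_rpow (abs_nonneg _)
      (lt_of_lt_of_le hst (min_le_right _ _)).le hα.1.le
    rwa [← Real.rpow_mul hq.le, one_div_mul_cancel hα.1.ne', Real.rpow_one] at h3
  have hp : 0 ≤ |s - t| ^ α := Real.rpow_nonneg (abs_nonneg _) _
  have h4 : |TS.fpow (s - t) α| ≤ |s - t| ^ α := by
    unfold TS.fpow
    rw [abs_mul, abs_of_nonneg hp]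
    have h5 : |Real.sign (s - t)| ≤ 1 := by
      rcases Real.sign_apply_eq (s - t) with h | h | h <;> rw [h] <;> norm_num
    exact mul_le_of_le_one_left hp h5
  have h6 : |L * TS.fpow (s - t) α| ≤ |L| * |s - t| ^ α := by
    rw [abs_mul]
    exact mul_le_mul_of_nonneg_left h4 (abs_nonneg _)
  have h7 := (le_div_iff₀ hC).1 h2
  have h8 := abs_add_le (f s - f t - L * TS.fpow (s - t) α) (L * TS.fpow (s - t) α)
  rw [sub_add_cancel] at h8
  nlinarith
end

section
/- Let 𝕋 be a time scale, f : 𝕋 → ℝ, t ∈ 𝕋_κ, and α ∈ ]0,1] not of the form 1/q with q an odd natural number. If t is left-dense and f is nabla fractional differentiable of order α at t, then f is right-continuous at t: for every ε > 0 there exists δ > 0 such that |f(s) − f(t)| ≤ ε for all s ∈ [t, t+δ[ ∩ 𝕋. -/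
open Set Filter Topology
open scoped Classical

/-- If `α ∈ ]0,1]` is not of the form `1/q` with `q` odd, `t ∈ 𝕋_κ` is
left-dense, and `f` is nabla fractional differentiable of order `α` at `t`,
then `f` is right-continuous at `t`. -/
theorem stmt1 (T : Set ℝ) (hTne : T.Nonempty) (hTcl : IsClosed T)
    (f : ℝ → ℝ) (t : ℝ) (ht : t ∈ TS.kappaLow T)
    (α : ℝ) (hα : α ∈ Set.Ioc (0:ℝ) 1) (hodd : ¬ TS.OddRecip α)
    (hld : TS.rho T t = t)
    (L : ℝ) (hL : TS.HasNablaFracDerivAt T f α t L) :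
    ∀ ε > (0:ℝ), ∃ δ > (0:ℝ), ∀ s ∈ T, t ≤ s → s < t + δ → |f s - f t| ≤ ε := by
  intro ε hε
  obtain ⟨δ, hδ, h⟩ := hL.2 hodd 1 one_pos
  rw [hld] at h
  have hK : 0 < |L| + 1 := by positivity
  have hc : 0 < ε / (|L| + 1) := by positivity
  refine ⟨min δ ((ε / (|L| + 1)) ^ (1 / α)), lt_min hδ (Real.rpow_pos_of_pos hc _), ?_⟩
  intro s hs hts hsd
  have h1 : s < t + δ := lt_of_lt_of_le hsd (by gcongr; exact min_le_left _ _)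
  have h2 : s - t ≤ (ε / (|L| + 1)) ^ (1 / α) := by
    have := min_le_right δ ((ε / (|L| + 1)) ^ (1 / α))
    linarith
  have h3 := h s hs hts h1
  have h0 : 0 ≤ s - t := by linarith
  have h4 : |s - t| ^ α ≤ ε / (|L| + 1) := by
    rw [abs_of_nonneg h0]
    calc (s - t) ^ α ≤ ((ε / (|L| + 1)) ^ (1 / α)) ^ α :=
          Real.rpow_le_rpow h0 h2 hα.1.le
      _ = ε / (|L| + 1) := by
          rw [← Real.rpow_mul hc.le, one_div_mul_cancel hα.1.ne', Real.rpow_one]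
  have hP : 0 ≤ |s - t| ^ α := by positivity
  have h5 : |L * TS.fpow (s - t) α| ≤ |L| * |s - t| ^ α := by
    rw [abs_mul]
    refine mul_le_mul_of_nonneg_left ?_ (abs_nonneg L)
    unfold TS.fpow
    rw [abs_mul, abs_of_nonneg hP]
    have : |Real.sign (s - t)| ≤ 1 := by
      rcases Real.sign_apply_eq (s - t) with h | h | h <;> rw [h] <;> norm_num
    nlinarith
  have h6 : |f s - f t| ≤ |f s - f t - L * TS.fpow (s - t) α| + |L * TS.fpow (s - t) α| := by
    simpa using abs_add_le (f s - f t - L * TS.fpow (s - t) α) (L * TS.fpow (s - t) α)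
  have h7 : (|L| + 1) * |s - t| ^ α ≤ ε := by
    rw [le_div_iff₀ hK] at h4
    linarith
  linarith
end

section
/- Let 𝕋 be a time scale, f : 𝕋 → ℝ, t ∈ 𝕋_κ, and α ∈ ]0,1]. If f is continuous at t (in the subspace topology of 𝕋) and t is left-scattered, then f is nabla fractional differentiable of order α at t with f^{∇^α}(t) = (f(t) − f(ρ(t)))/(t − ρ(t))^α. -/
open Set Filter Topology
open scoped Classical

/-- If `f` is continuous at `t ∈ 𝕋_κ` and `t` is left-scattered, then `f` is
nabla fractional differentiable of order `α` at `t` with derivative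
`(f(t) - f(ρ(t))) / (t - ρ(t))^α`. -/
theorem stmt2 (T : Set ℝ) (hTne : T.Nonempty) (hTcl : IsClosed T)
    (f : ℝ → ℝ) (t : ℝ) (ht : t ∈ TS.kappaLow T)
    (α : ℝ) (hα : α ∈ Set.Ioc (0:ℝ) 1)
    (hcont : ContinuousWithinAt f T t) (hls : TS.rho T t < t) :
    TS.HasNablaFracDerivAt T f α t
      ((f t - f (TS.rho T t)) / TS.fpow (t - TS.rho T t) α) := by
  have hr : 0 < t - TS.rho T t := sub_pos.mpr hls
  unfold TS.HasNablaFracDerivAt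
  generalize TS.rho T t = r at *
  have hp : 0 < (t - r) ^ α := Real.rpow_pos_of_pos hr α
  have key : ∀ ε > (0:ℝ), ∃ δ > (0:ℝ), ∀ s ∈ T, |s - t| < δ →
      |(f s - f r) - ((f t - f r) / TS.fpow (t - r) α) * TS.fpow (s - r) α|
        ≤ ε * |s - r| ^ α := by
    intro ε hε
    have hft : TS.fpow (t - r) α = (t - r) ^ α := by
      simp [TS.fpow, Real.sign_of_pos hr, abs_of_pos hr]
    rw [hft]
    have hc : ContinuousWithinAt (fun s => (s - r) ^ α) T t :=
      ContinuousWithinAt.rpow_const (by fun_prop) (Or.inl hr.ne')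
    have h1 : ContinuousWithinAt (fun s => |(f s - f r) -
        ((f t - f r) / (t - r) ^ α) * (s - r) ^ α|) T t :=
      ((hcont.sub continuousWithinAt_const).sub (continuousWithinAt_const.mul hc)).abs
    have h2 : ContinuousWithinAt (fun s => ε * (s - r) ^ α) T t :=
      continuousWithinAt_const.mul hc
    have h3 := Filter.Tendsto.eventually_lt h1 h2 (by
      beta_reduce
      rw [div_mul_cancel₀ _ hp.ne', sub_self, abs_zero]
      positivity)
    obtain ⟨δ, hδ, h⟩ := Metric.mem_nhdsWithin_iff.mp h3
    refine ⟨min δ (t - r), lt_min hδ hr, fun s hs hst => ?_⟩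
    have hsr : 0 < s - r := by
      have := (abs_lt.mp (lt_of_lt_of_le hst (min_le_right _ _))).1
      linarith
    have hfs : TS.fpow (s - r) α = (s - r) ^ α := by
      simp [TS.fpow, Real.sign_of_pos hsr, abs_of_pos hsr]
    rw [hfs, abs_of_pos hsr]
    have hm : s ∈ Metric.ball t δ ∩ T :=
      ⟨by rw [Metric.mem_ball, Real.dist_eq]; exact lt_of_lt_of_le hst (min_le_left _ _), hs⟩
    exact le_of_lt (h hm)
  refine ⟨fun _ => key, fun _ ε hε => ?_⟩
  obtain ⟨δ, hδ, h⟩ := key ε hε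
  refine ⟨δ, hδ, fun s hs h1 h2 => h s hs ?_⟩
  rw [abs_of_nonneg (by linarith)]
  linarith
end

section
/- Let 𝕋 be a time scale, f : 𝕋 → ℝ, t ∈ 𝕋_κ, and α ∈ ]0,1] with α = 1/q for some odd natural number q. If t is left-dense, then f is nabla fractional differentiable of order α at t if and only if the limit of (f(s) − f(t))/(s − t)^α as s → t with s ∈ 𝕋 ∖ {t} exists as a finite number; in this case f^{∇^α}(t) equals this limit. -/
open Set Filter Topology
open scoped Classical

/-- For `α = 1/q` with `q` odd and `t ∈ 𝕋_κ` left-dense: `f` is nabla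
fractional differentiable of order `α` at `t` with derivative `L` iff
`(f(s) - f(t))/(s - t)^α → L` as `s → t`, `s ∈ 𝕋 \ {t}`. -/
theorem stmt3 (T : Set ℝ) (hTne : T.Nonempty) (hTcl : IsClosed T)
    (f : ℝ → ℝ) (t : ℝ) (ht : t ∈ TS.kappaLow T)
    (α : ℝ) (hα : α ∈ Set.Ioc (0:ℝ) 1) (hodd : TS.OddRecip α)
    (hld : TS.rho T t = t) :
    ∀ L : ℝ, TS.HasNablaFracDerivAt T f α t L ↔
      Filter.Tendsto (fun s => (f s - f t) / TS.fpow (s - t) α)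
        (𝓝[T \ {t}] t) (𝓝 L) := by
  intro L
  have key : ∀ s, s ≠ t → ∀ ε : ℝ,
      (|(f s - f t) - L * TS.fpow (s - t) α| ≤ ε * |s - t| ^ α ↔
        |(f s - f t) / TS.fpow (s - t) α - L| ≤ ε) := by
    intro s hs ε
    have h0 : s - t ≠ 0 := sub_ne_zero.mpr hs
    have hpos : 0 < |s - t| ^ α := Real.rpow_pos_of_pos (abs_pos.mpr h0) α
    have habs : |TS.fpow (s - t) α| = |s - t| ^ α := by
      unfold TS.fpow
      rw [abs_mul, abs_of_pos hpos]
      rcases Real.sign_apply_eq_of_ne_zero _ h0 with h | h <;> simp [h]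
    have hne : TS.fpow (s - t) α ≠ 0 := by
      intro h
      rw [h, abs_zero] at habs
      exact hpos.ne habs
    have e : (f s - f t) - L * TS.fpow (s - t) α
        = ((f s - f t) / TS.fpow (s - t) α - L) * TS.fpow (s - t) α := by
      field_simp
    rw [e, abs_mul, habs]
    exact mul_le_mul_iff_left₀ hpos
  unfold TS.HasNablaFracDerivAt
  rw [hld, Metric.tendsto_nhdsWithin_nhds]
  simp only [Real.dist_eq]
  constructor
  · rintro ⟨h, -⟩ ε hε
    obtain ⟨δ, hδ, H⟩ := h hodd (ε / 2) (half_pos hε)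
    refine ⟨δ, hδ, fun s hs hd => ?_⟩
    have := (key s hs.2 _).1 (H s hs.1 hd)
    linarith
  · intro h
    refine ⟨fun _ ε hε => ?_, fun hn => absurd hodd hn⟩
    obtain ⟨δ, hδ, H⟩ := h ε hε
    refine ⟨δ, hδ, fun s hs hd => ?_⟩
    by_cases hst : s = t
    · subst hst
      simp [TS.fpow, Real.zero_rpow hα.1.ne']
    · exact (key s hst _).2 (H ⟨hs, hst⟩ hd).le
end

section
/- Let 𝕋 be a time scale, f : 𝕋 → ℝ, t ∈ 𝕋_κ, and α ∈ ]0,1] not of the form 1/q with q an odd natural number. If t is left-dense, then f is nabla fractional differentiable of order α at t if and only if the right-sided limit of (f(s) − f(t))/(s − t)^α as s → t⁺ with s ∈ 𝕋, s > t, exists as a finite number; in this case f^{∇^α}(t) equals this limit. -/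
open Set Filter Topology
open scoped Classical

/-- For `α ∈ ]0,1]` not of the form `1/q` with `q` odd and `t ∈ 𝕋_κ`
left-dense: `f` is nabla fractional differentiable of order `α` at `t` with
derivative `L` iff `(f(s) - f(t))/(s - t)^α → L` as `s → t⁺`, `s ∈ 𝕋`, `s > t`. -/
theorem stmt4 (T : Set ℝ) (hTne : T.Nonempty) (hTcl : IsClosed T)
    (f : ℝ → ℝ) (t : ℝ) (ht : t ∈ TS.kappaLow T)
    (α : ℝ) (hα : α ∈ Set.Ioc (0:ℝ) 1) (hodd : ¬ TS.OddRecip α)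
    (hld : TS.rho T t = t) :
    ∀ L : ℝ, TS.HasNablaFracDerivAt T f α t L ↔
      Filter.Tendsto (fun s => (f s - f t) / TS.fpow (s - t) α)
        (𝓝[T ∩ Set.Ioi t] t) (𝓝 L) := by
  intro L
  have key : ∀ s, t < s → ∀ ε : ℝ,
      (|(f s - f t) - L * TS.fpow (s - t) α| ≤ ε * |s - t| ^ α ↔
        |(f s - f t) / TS.fpow (s - t) α - L| ≤ ε) := by
    intro s hs ε
    have h0 : 0 < s - t := sub_pos.2 hs
    have hp : 0 < (s - t) ^ α := Real.rpow_pos_of_pos h0 α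
    have hf : TS.fpow (s - t) α = (s - t) ^ α := by
      simp [TS.fpow, Real.sign_of_pos h0, abs_of_pos h0]
    rw [hf, abs_of_pos h0, div_sub' hp.ne', abs_div, abs_of_pos hp, div_le_iff₀ hp,
      mul_comm L]
  unfold TS.HasNablaFracDerivAt
  rw [hld, Metric.tendsto_nhdsWithin_nhds]
  constructor
  · rintro ⟨-, h⟩ ε hε
    obtain ⟨δ, hδ, h⟩ := h hodd (ε / 2) (half_pos hε)
    refine ⟨δ, hδ, ?_⟩
    rintro s ⟨hsT, hs⟩ hd
    have hs' : t < s := hs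
    rw [Real.dist_eq] at hd ⊢
    have h1 := (key s hs' _).1 (h s hsT hs'.le (by linarith [(abs_lt.1 hd).2]))
    linarith
  · intro h
    refine ⟨fun h' => absurd h' hodd, fun _ ε hε => ?_⟩
    obtain ⟨δ, hδ, h⟩ := h ε hε
    refine ⟨δ, hδ, fun s hsT hts hs => ?_⟩
    rcases hts.eq_or_lt with rfl | hlt
    · simp [TS.fpow, Real.zero_rpow hα.1.ne']
    · rw [key s hlt]
      have h2 := h (x := s) ⟨hsT, hlt⟩ (by
        rw [Real.dist_eq, abs_lt]; constructor <;> linarith)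
      rw [Real.dist_eq] at h2
      exact h2.le
end

section
/- Let 𝕋 be a time scale, f : 𝕋 → ℝ, t ∈ 𝕋_κ, and α ∈ ]0,1]. If f is nabla fractional differentiable of order α at t, then f(t) = f(ρ(t)) + (t − ρ(t))^α · f^{∇^α}(t). -/
open Set Filter Topology
open scoped Classical

/-- If `f` is nabla fractional differentiable of order `α` at `t ∈ 𝕋_κ`, then
`f(t) = f(ρ(t)) + (t - ρ(t))^α · f^{∇^α}(t)`. -/
theorem stmt5 (T : Set ℝ) (hTne : T.Nonempty) (hTcl : IsClosed T)
    (f : ℝ → ℝ) (t : ℝ) (ht : t ∈ TS.kappaLow T)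
    (α : ℝ) (hα : α ∈ Set.Ioc (0:ℝ) 1)
    (L : ℝ) (hL : TS.HasNablaFracDerivAt T f α t L) :
    f t = f (TS.rho T t) + TS.fpow (t - TS.rho T t) α * L := by
  have key : ∀ ε > (0:ℝ), |(f t - f (TS.rho T t)) - L * TS.fpow (t - TS.rho T t) α|
        ≤ ε * |t - TS.rho T t| ^ α := by
    intro ε hε
    by_cases h : TS.OddRecip α
    · obtain ⟨δ, hδ, H⟩ := hL.1 h ε hε
      exact H t ht.1 (by simpa using hδ)
    · obtain ⟨δ, hδ, H⟩ := hL.2 h ε hε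
      exact H t ht.1 le_rfl (by linarith)
  have hc : 0 ≤ |t - TS.rho T t| ^ α := Real.rpow_nonneg (abs_nonneg _) _
  have h0 : |(f t - f (TS.rho T t)) - L * TS.fpow (t - TS.rho T t) α| ≤ 0 := by
    apply le_of_forall_pos_le_add
    intro e he
    have hpos : 0 < |t - TS.rho T t| ^ α + 1 := by linarith
    have h1 := key (e / (|t - TS.rho T t| ^ α + 1)) (div_pos he hpos)
    refine h1.trans ?_
    rw [zero_add, div_mul_eq_mul_div, div_le_iff₀ hpos]
    nlinarith
  have h2 := abs_nonpos_iff.mp h0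
  linarith
end

section
/- Let f : ℝ → ℝ be differentiable at t ∈ ℝ and let α ∈ ]0,1[. Then the nabla fractional derivative of f of order α at t (with time scale 𝕋 = ℝ) is zero; equivalently, the limit of (f(s) − f(t))/(s − t)^α as s → t (right-sided limit s → t⁺ when α is not of the form 1/q with q odd) equals 0. -/
open Set Filter Topology
open scoped Classical

theorem TS.rho_univ_eq (t : ℝ) : TS.rho Set.univ t = t := by
  have h : {s : ℝ | s ∈ (Set.univ : Set ℝ) ∧ s < t} = Set.Iio t := by
    ext s; simp
  unfold TS.rho
  rw [h, if_pos ⟨t - 1, by simp⟩, csSup_Iio]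

theorem TS.key_bound (f : ℝ → ℝ) (t : ℝ) (hf : DifferentiableAt ℝ f t)
    (α : ℝ) (hα : α ∈ Set.Ioo (0:ℝ) 1) (ε : ℝ) (hε : 0 < ε) :
    ∃ δ > (0:ℝ), ∀ s : ℝ, |s - t| < δ → |f s - f t| ≤ ε * |s - t| ^ α := by
  obtain ⟨h0, h1⟩ := hα
  obtain ⟨C, hC, hb⟩ := hf.isBigO_sub.exists_pos
  have hb' := hb.bound
  have hlim : Tendsto (fun s : ℝ => C * |s - t| ^ (1 - α)) (𝓝 t) (𝓝 0) := by
    have hc : Continuous (fun s : ℝ => C * |s - t| ^ (1 - α)) :=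
      continuous_const.mul
        ((continuous_abs.comp (continuous_id.sub continuous_const)).rpow_const
          (fun _ => Or.inr (by linarith)))
    have := hc.tendsto t
    simpa [Real.zero_rpow (show (1 - α) ≠ 0 by linarith)] using this
  have hev := hb'.and (hlim.eventually (gt_mem_nhds hε))
  obtain ⟨δ, hδ, H⟩ := Metric.eventually_nhds_iff.1 hev
  refine ⟨δ, hδ, fun s hs => ?_⟩
  obtain ⟨ha, hl⟩ := H (y := s) (by rwa [Real.dist_eq])
  simp only [Real.norm_eq_abs] at ha
  have hsplit : |s - t| = |s - t| ^ (1 - α) * |s - t| ^ α := by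
    rw [← Real.rpow_add_of_nonneg (abs_nonneg _) (by linarith) h0.le]
    simp
  calc |f s - f t| ≤ C * |s - t| := ha
    _ = (C * |s - t| ^ (1 - α)) * |s - t| ^ α := by rw [mul_assoc, ← hsplit]
    _ ≤ ε * |s - t| ^ α :=
      mul_le_mul_of_nonneg_right hl.le (Real.rpow_nonneg (abs_nonneg _) _)

/-- If `f : ℝ → ℝ` is differentiable at `t` and `α ∈ ]0,1[`, then the nabla
fractional derivative of `f` of order `α` at `t` (time scale `𝕋 = ℝ`) is `0`. -/
theorem stmt11 (f : ℝ → ℝ) (t : ℝ) (hf : DifferentiableAt ℝ f t)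
    (α : ℝ) (hα : α ∈ Set.Ioo (0:ℝ) 1) :
    TS.HasNablaFracDerivAt Set.univ f α t 0 := by
  unfold TS.HasNablaFracDerivAt
  rw [TS.rho_univ_eq]
  simp only [zero_mul, sub_zero]
  refine ⟨fun _ ε hε => ?_, fun _ ε hε => ?_⟩
  · obtain ⟨δ, hδ, H⟩ := TS.key_bound f t hf α hα ε hε
    exact ⟨δ, hδ, fun s _ hs => H s hs⟩
  · obtain ⟨δ, hδ, H⟩ := TS.key_bound f t hf α hα ε hε
    refine ⟨δ, hδ, fun s _ h1 h2 => H s ?_⟩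
    rw [abs_of_nonneg (by linarith)]
    linarith
end

section
/- Let 𝕋 be a time scale, α ∈ ]0,1], and let f, g : 𝕋 → ℝ be continuous functions that are nabla fractional differentiable of order α at t ∈ 𝕋_κ. Then the product fg is nabla fractional differentiable of order α at t and (fg)^{∇^α}(t) = f^{∇^α}(t)·g(t) + f(ρ(t))·g^{∇^α}(t) = f^{∇^α}(t)·g(ρ(t)) + f(t)·g^{∇^α}(t). -/
open Set Filter Topology
open scoped Classical

theorem TS.abs_fpow_le (x α : ℝ) : |TS.fpow x α| ≤ |x| ^ α := by
  unfold TS.fpow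
  have h := Real.rpow_nonneg (abs_nonneg x) α
  rw [abs_mul, abs_of_nonneg h]
  have : |Real.sign x| ≤ 1 := by
    rcases Real.sign_apply_eq x with h | h | h <;> simp [h]
  nlinarith

theorem TS.prod_aux (F G gt fr gr ε : ℝ) (hε : 0 < ε) : ∃ η > (0:ℝ), ∀ fs gs P A : ℝ,
    |P| ≤ A → |fs - fr - F * P| ≤ η * A → |gs - gr - G * P| ≤ η * A → |gs - gt| < η →
    |fs * gs - fr * gr - (F * gt + fr * G) * P| ≤ ε * A := by
  have hK : 0 < |gt| + 1 + |F| + |fr| := by positivity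
  refine ⟨min 1 (ε / (|gt| + 1 + |F| + |fr|)), by positivity, ?_⟩
  intro fs gs P A hP h1 h2 h3
  set η := min 1 (ε / (|gt| + 1 + |F| + |fr|)) with hη
  have hη0 : 0 < η := by positivity
  have hη1 : η ≤ 1 := min_le_left _ _
  have hηK : η * (|gt| + 1 + |F| + |fr|) ≤ ε := by
    rw [← le_div_iff₀ hK]; exact min_le_right _ _
  have hA : 0 ≤ A := (abs_nonneg P).trans hP
  have hgs : |gs| ≤ |gt| + 1 := by
    have := abs_sub_abs_le_abs_sub gs gt
    linarith
  have e : fs * gs - fr * gr - (F * gt + fr * G) * P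
      = (fs - fr - F * P) * gs + F * (P * (gs - gt)) + fr * (gs - gr - G * P) := by ring
  rw [e]
  have a1 : |(fs - fr - F * P) * gs| ≤ (η * A) * (|gt| + 1) := by
    rw [abs_mul]; gcongr
  have a2 : |F * (P * (gs - gt))| ≤ |F| * (A * η) := by
    rw [abs_mul, abs_mul]; gcongr
  have a3 : |fr * (gs - gr - G * P)| ≤ |fr| * (η * A) := by
    rw [abs_mul]; gcongr
  have a4 := mul_le_mul_of_nonneg_right hηK hA
  have a5 := abs_add_three ((fs - fr - F * P) * gs) (F * (P * (gs - gt))) (fr * (gs - gr - G * P))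
  linarith

theorem TS.eq_at (T : Set ℝ) (f : ℝ → ℝ) (α t L : ℝ) (ht : t ∈ T)
    (hf : TS.HasNablaFracDerivAt T f α t L) :
    f t - f (TS.rho T t) = L * TS.fpow (t - TS.rho T t) α := by
  have key : ∀ ε > (0:ℝ), |(f t - f (TS.rho T t)) - L * TS.fpow (t - TS.rho T t) α|
        ≤ ε * |t - TS.rho T t| ^ α := by
    intro ε hε
    by_cases h : TS.OddRecip α
    · obtain ⟨δ, hδ, H⟩ := hf.1 h ε hε
      exact H t ht (by simpa using hδ)
    · obtain ⟨δ, hδ, H⟩ := hf.2 h ε hε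
      exact H t ht le_rfl (by linarith)
  have hA := Real.rpow_nonneg (abs_nonneg (t - TS.rho T t)) α
  set A := |t - TS.rho T t| ^ α
  have : |(f t - f (TS.rho T t)) - L * TS.fpow (t - TS.rho T t) α| ≤ 0 := by
    refine le_of_forall_pos_le_add fun ε hε => ?_
    refine (key (ε / (A + 1)) (by positivity)).trans ?_
    rw [zero_add, div_mul_eq_mul_div, div_le_iff₀ (by positivity)]
    nlinarith
  have := abs_nonpos_iff.1 this
  linarith

/-- Product rule for the nabla fractional derivative. -/
theorem stmt13 (T : Set ℝ) (hTne : T.Nonempty) (hTcl : IsClosed T)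
    (f g : ℝ → ℝ) (t : ℝ) (ht : t ∈ TS.kappaLow T)
    (α : ℝ) (hα : α ∈ Set.Ioc (0:ℝ) 1) (F G : ℝ)
    (hfc : ContinuousOn f T) (hgc : ContinuousOn g T)
    (hf : TS.HasNablaFracDerivAt T f α t F)
    (hg : TS.HasNablaFracDerivAt T g α t G) :
    TS.HasNablaFracDerivAt T (fun s => f s * g s) α t
      (F * g t + f (TS.rho T t) * G) ∧
    F * g t + f (TS.rho T t) * G = F * g (TS.rho T t) + f t * G := by
  have htT : t ∈ T := ht.1
  have hc := Metric.continuousWithinAt_iff.1 (hgc t htT)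
  refine ⟨⟨fun h ε hε => ?_, fun h ε hε => ?_⟩, ?_⟩
  · obtain ⟨η, hη, H⟩ := TS.prod_aux F G (g t) (f (TS.rho T t)) (g (TS.rho T t)) ε hε
    obtain ⟨δ₁, h₁, H1⟩ := hf.1 h η hη
    obtain ⟨δ₂, h₂, H2⟩ := hg.1 h η hη
    obtain ⟨δ₃, h₃, H3⟩ := hc η hη
    refine ⟨min δ₁ (min δ₂ δ₃), by positivity, fun s hs hst => ?_⟩
    simp only [lt_min_iff] at hst
    exact H _ _ _ _ (TS.abs_fpow_le _ _) (H1 s hs hst.1) (H2 s hs hst.2.1)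
      (H3 hs hst.2.2)
  · obtain ⟨η, hη, H⟩ := TS.prod_aux F G (g t) (f (TS.rho T t)) (g (TS.rho T t)) ε hε
    obtain ⟨δ₁, h₁, H1⟩ := hf.2 h η hη
    obtain ⟨δ₂, h₂, H2⟩ := hg.2 h η hη
    obtain ⟨δ₃, h₃, H3⟩ := hc η hη
    refine ⟨min δ₁ (min δ₂ δ₃), by positivity, fun s hs hts hst => ?_⟩
    rw [← sub_lt_iff_lt_add'] at hst
    simp only [lt_min_iff] at hst
    refine H _ _ _ _ (TS.abs_fpow_le _ _) (H1 s hs hts (by linarith)) (H2 s hs hts (by linarith))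
      (H3 hs ?_)
    rw [Real.dist_eq, abs_of_nonneg (by linarith)]
    exact hst.2.2
  · have e1 := TS.eq_at T f α t F htT hf
    have e2 := TS.eq_at T g α t G htT hg
    linear_combination F * e2 - G * e1
end

section
/- Let 𝕋 be a time scale, α ∈ ]0,1], and let f : 𝕋 → ℝ be a continuous function, nabla fractional differentiable of order α at t ∈ 𝕋_κ, with f(ρ(t))·f(t) ≠ 0. Then the function 1/f is nabla fractional differentiable of order α at t with (1/f)^{∇^α}(t) = −f^{∇^α}(t)/(f(ρ(t))·f(t)). -/
open Set Filter Topology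
open scoped Classical

theorem TS.recip_key (R a F ε : ℝ) (hR : R ≠ 0) (ha : a ≠ 0) (hε : 0 < ε) :
    ∃ ε₁ > (0:ℝ), ∃ η > (0:ℝ), ∀ b p P : ℝ, |p| ≤ P → |b - a| < η →
      |(b - R) - F * p| ≤ ε₁ * P → |(1 / b - 1 / R) - (-(F / (R * a))) * p| ≤ ε * P := by
  have hR' : 0 < |R| := abs_pos.mpr hR
  have ha' : 0 < |a| := abs_pos.mpr ha
  refine ⟨ε * (|a| / 2) * |R| / 2, by positivity,
    min (|a| / 2) (ε * (|a| / 2) * |a| * |R| / (2 * (|F| + 1))), by positivity, ?_⟩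
  intro b p P hp hb h
  have hP : 0 ≤ P := (abs_nonneg p).trans hp
  have hb1 := hb.trans_le (min_le_left _ _)
  have hb2 := hb.trans_le (min_le_right _ _)
  have hbl : |a| / 2 ≤ |b| := by
    have := abs_sub_abs_le_abs_sub a b
    rw [abs_sub_comm a b] at this
    linarith
  have hb' : 0 < |b| := by linarith
  have hb0 : b ≠ 0 := abs_pos.mp hb'
  have e : (1 / b - 1 / R) - (-(F / (R * a))) * p
      = (-(((b - R) - F * p) * a) + F * p * (b - a)) / (b * a * R) := by
    field_simp
    ring
  rw [e, abs_div, div_le_iff₀ (by positivity), abs_mul, abs_mul]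
  have h1 : |-(((b - R) - F * p) * a)| ≤ ε * (|a| / 2) * |R| / 2 * P * |a| := by
    rw [abs_neg, abs_mul]
    gcongr
  have h2 : |F * p * (b - a)| ≤ ε * (|a| / 2) * |R| / 2 * P * |a| := by
    rw [abs_mul, abs_mul]
    rw [lt_div_iff₀ (by positivity)] at hb2
    have h3 : |F| * |b - a| ≤ ε * (|a| / 2) * |a| * |R| / 2 := by
      nlinarith [abs_nonneg (b - a)]
    calc |F| * |p| * |b - a| = (|F| * |b - a|) * |p| := by ring
      _ ≤ (ε * (|a| / 2) * |a| * |R| / 2) * P := by gcongr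
      _ = _ := by ring
  calc _ ≤ _ := abs_add_le _ _
    _ ≤ _ := add_le_add h1 h2
    _ = ε * P * ((|a| / 2) * |a| * |R|) := by ring
    _ ≤ _ := by gcongr

/-- Reciprocal rule for the nabla fractional derivative. -/
theorem stmt14 (T : Set ℝ) (hTne : T.Nonempty) (hTcl : IsClosed T)
    (f : ℝ → ℝ) (t : ℝ) (ht : t ∈ TS.kappaLow T)
    (α : ℝ) (hα : α ∈ Set.Ioc (0:ℝ) 1) (F : ℝ)
    (hfc : ContinuousOn f T)
    (hf : TS.HasNablaFracDerivAt T f α t F)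
    (hne : f (TS.rho T t) * f t ≠ 0) :
    TS.HasNablaFracDerivAt T (fun s => 1 / f s) α t
      (-(F / (f (TS.rho T t) * f t))) := by
  have hR := left_ne_zero_of_mul hne
  have ha := right_ne_zero_of_mul hne
  have hc := Metric.continuousOn_iff.mp hfc t ht.1
  constructor
  · intro ho ε hε
    obtain ⟨ε₁, hε₁, η, hη, key⟩ := TS.recip_key _ _ F ε hR ha hε
    obtain ⟨δ₁, hδ₁, h1⟩ := hf.1 ho ε₁ hε₁
    obtain ⟨δ₂, hδ₂, h2⟩ := hc η hη
    refine ⟨min δ₁ δ₂, lt_min hδ₁ hδ₂, fun s hs hst => ?_⟩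
    exact key _ _ _ (TS.abs_fpow_le _ _) (h2 s hs (hst.trans_le (min_le_right _ _)))
      (h1 s hs (hst.trans_le (min_le_left _ _)))
  · intro ho ε hε
    obtain ⟨ε₁, hε₁, η, hη, key⟩ := TS.recip_key _ _ F ε hR ha hε
    obtain ⟨δ₁, hδ₁, h1⟩ := hf.2 ho ε₁ hε₁
    obtain ⟨δ₂, hδ₂, h2⟩ := hc η hη
    refine ⟨min δ₁ δ₂, lt_min hδ₁ hδ₂, fun s hs hts hst => ?_⟩
    have m1 := min_le_left δ₁ δ₂
    have m2 := min_le_right δ₁ δ₂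
    refine key _ _ _ (TS.abs_fpow_le _ _) (h2 s hs ?_) (h1 s hs hts (by linarith))
    rw [Real.dist_eq, abs_of_nonneg (by linarith)]
    linarith
end

section
/- Let 𝕋 be a time scale, f : 𝕋 → ℝ, t ∈ 𝕋_κ^κ, and α ∈ ]0,1]. If f is continuous at t (in the subspace topology of 𝕋) and t is not dense (i.e., ρ(t) < σ(t)), then f is symmetric fractional differentiable of order α at t with f^{◇^α}(t) = (f(σ(t)) − f(ρ(t)))/(σ(t) − ρ(t))^α. -/
open Set Filter Topology
open scoped Classical

/-- If `f` is continuous at `t ∈ 𝕋_κ^κ` and `t` is not dense, then `f` is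
symmetric fractional differentiable of order `α` at `t` with derivative
`(f(σ(t)) - f(ρ(t)))/(σ(t) - ρ(t))^α`. -/
theorem stmt18 (T : Set ℝ) (hTne : T.Nonempty) (hTcl : IsClosed T)
    (f : ℝ → ℝ) (t : ℝ) (ht : t ∈ TS.kappaLow T ∩ TS.kappaHigh T)
    (α : ℝ) (hα : α ∈ Set.Ioc (0:ℝ) 1)
    (hcont : ContinuousWithinAt f T t)
    (hnd : TS.rho T t < TS.sigma T t) :
    TS.HasSymFracDerivAt T f α t
      ((f (TS.sigma T t) - f (TS.rho T t)) /
        TS.fpow (TS.sigma T t - TS.rho T t) α) := by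
  have hs : ∀ s ∈ T, t < s → TS.sigma T t ≤ s := by
    intro s hs hts
    have hne : ({s | s ∈ T ∧ t < s}).Nonempty := ⟨s, hs, hts⟩
    unfold TS.sigma
    rw [if_pos hne]
    exact csInf_le ⟨t, fun x hx => hx.2.le⟩ ⟨hs, hts⟩
  have hr : ∀ s ∈ T, s < t → s ≤ TS.rho T t := by
    intro s hs hts
    have hne : ({s | s ∈ T ∧ s < t}).Nonempty := ⟨s, hs, hts⟩
    unfold TS.rho
    rw [if_pos hne]
    exact le_csSup ⟨t, fun x hx => hx.2.le⟩ ⟨hs, hts⟩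
  have key : ∃ δ > (0:ℝ), ∀ s ∈ T, |s - t| < δ → 2 * t - s ∈ T → s = t := by
    by_cases h : t < TS.sigma T t
    · refine ⟨TS.sigma T t - t, by linarith, fun s h1 h2 h3 => ?_⟩
      rw [abs_lt] at h2
      rcases lt_trichotomy s t with h4 | h4 | h4
      · have := hs _ h3 (by linarith)
        linarith
      · exact h4
      · have := hs _ h1 h4
        linarith
    · refine ⟨t - TS.rho T t, by linarith, fun s h1 h2 h3 => ?_⟩
      rw [abs_lt] at h2
      rcases lt_trichotomy s t with h4 | h4 | h4
      · have := hr _ h1 h4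
        linarith
      · exact h4
      · have := hr _ h3 (by linarith)
        linarith
  intro ε hε
  obtain ⟨δ, hδ, hk⟩ := key
  refine ⟨δ, hδ, fun s h1 h2 h3 _ => ?_⟩
  obtain rfl := hk s h1 h2 h3
  have e1 : TS.sigma T s + 2 * s - 2 * s - TS.rho T s = TS.sigma T s - TS.rho T s := by ring
  have e2 : 2 * s - s = s := by ring
  have hpos : 0 < TS.sigma T s - TS.rho T s := by linarith
  have hf : TS.fpow (TS.sigma T s - TS.rho T s) α ≠ 0 := by
    unfold TS.fpow
    rw [Real.sign_of_pos hpos, one_mul]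
    exact (Real.rpow_pos_of_pos (abs_pos.mpr hpos.ne') α).ne'
  rw [e1, e2, div_mul_cancel₀ _ hf]
  have e3 : f (TS.sigma T s) - f s + f s - f (TS.rho T s)
      - (f (TS.sigma T s) - f (TS.rho T s)) = 0 := by ring
  rw [e3, abs_zero]
  positivity
end

section
/- Let 𝕋 be a time scale, f : 𝕋 → ℝ, t ∈ 𝕋_κ^κ, and α ∈ ]0,1]. If t is dense (ρ(t) = t = σ(t)), then f is symmetric fractional differentiable of order α at t if and only if the limit of (f(2t − s) − f(s))/(2^α (t − s)^α) as s → t (over s ∈ 𝕋 ∖ {t} with 2t − s ∈ 𝕋) exists as a finite number; in this case f^{◇^α}(t) equals this limit. -/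
open Set Filter Topology
open scoped Classical

/-- If `t ∈ 𝕋_κ^κ` is dense, then `f` is symmetric fractional differentiable
of order `α` at `t` with derivative `L` iff
`(f(2t - s) - f(s))/(2^α (t - s)^α) → L` as `s → t` over
`s ∈ 𝕋 \ {t}` with `2t - s ∈ 𝕋`. -/
theorem stmt19 (T : Set ℝ) (hTne : T.Nonempty) (hTcl : IsClosed T)
    (f : ℝ → ℝ) (t : ℝ) (ht : t ∈ TS.kappaLow T ∩ TS.kappaHigh T)
    (α : ℝ) (hα : α ∈ Set.Ioc (0:ℝ) 1)
    (hρ : TS.rho T t = t) (hσ : TS.sigma T t = t) :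
    ∀ L : ℝ, TS.HasSymFracDerivAt T f α t L ↔
      Filter.Tendsto (fun s => (f (2 * t - s) - f s) / ((2:ℝ) ^ α * TS.fpow (t - s) α))
        (𝓝[{s | s ∈ T ∧ s ≠ t ∧ 2 * t - s ∈ T}] t) (𝓝 L) := by
  intro L
  obtain ⟨hα0, hα1⟩ := hα
  have hD : ∀ s : ℝ, TS.fpow (t + 2 * t - 2 * s - t) α = (2:ℝ) ^ α * TS.fpow (t - s) α := by
    intro s
    have e : t + 2 * t - 2 * s - t = 2 * (t - s) := by ring
    have hs : Real.sign (2 * (t - s)) = Real.sign (t - s) := by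
      rcases lt_trichotomy (t - s) 0 with h | h | h
      · rw [Real.sign_of_neg h, Real.sign_of_neg (by linarith)]
      · rw [h, mul_zero]
      · rw [Real.sign_of_pos h, Real.sign_of_pos (by linarith)]
    unfold TS.fpow
    rw [e, hs, abs_mul, abs_two, Real.mul_rpow (by norm_num) (abs_nonneg _)]
    ring
  have hA : ∀ s : ℝ, s ≠ t → |(2:ℝ) ^ α * TS.fpow (t - s) α| = |t + 2 * t - 2 * s - t| ^ α := by
    intro s hs
    rw [← hD]
    have hne : t + 2 * t - 2 * s - t ≠ 0 := fun h => hs (by linarith)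
    unfold TS.fpow
    rw [abs_mul, abs_of_nonneg (Real.rpow_nonneg (abs_nonneg _) _)]
    rcases Real.sign_apply_eq_of_ne_zero _ hne with h | h <;> rw [h] <;> simp
  have hP : ∀ s : ℝ, s ≠ t → 0 < |t + 2 * t - 2 * s - t| ^ α := by
    intro s hs
    have hne : t + 2 * t - 2 * s - t ≠ 0 := fun h => hs (by linarith)
    exact Real.rpow_pos_of_pos (abs_pos.mpr hne) _
  have key : ∀ s : ℝ, s ≠ t →
      |(f t - f s + f (2 * t - s) - f t) - L * TS.fpow (t + 2 * t - 2 * s - t) α|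
      = |(f (2 * t - s) - f s) / ((2:ℝ) ^ α * TS.fpow (t - s) α) - L|
        * |t + 2 * t - 2 * s - t| ^ α := by
    intro s hs
    have hne : (2:ℝ) ^ α * TS.fpow (t - s) α ≠ 0 := by
      rw [← abs_pos, hA s hs]; exact hP s hs
    rw [← hA s hs, ← abs_mul, sub_mul, div_mul_cancel₀ _ hne, hD]
    congr 1
    ring
  rw [Metric.tendsto_nhdsWithin_nhds]
  unfold TS.HasSymFracDerivAt
  rw [hρ, hσ]
  constructor
  · intro h ε hε
    obtain ⟨δ, hδ, H⟩ := h (ε / 2) (by linarith)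
    refine ⟨δ, hδ, ?_⟩
    rintro s ⟨hsT, hst, hsT2⟩ hd
    rw [Real.dist_eq] at hd ⊢
    have h1 := H s hsT hd hsT2 (by
      rw [show 2 * t - s - t = -(s - t) by ring, abs_neg]; exact hd)
    rw [key s hst] at h1
    have := le_of_mul_le_mul_right h1 (hP s hst)
    linarith
  · intro h ε hε
    obtain ⟨δ, hδ, H⟩ := h ε hε
    refine ⟨δ, hδ, ?_⟩
    intro s hsT hd hsT2 _
    by_cases hst : s = t
    · subst hst
      have e : s + 2 * s - 2 * s - s = 0 := by ring
      have e2 : 2 * s - s = s := by ring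
      rw [e, e2]
      simp [TS.fpow, Real.zero_rpow hα0.ne']
    · rw [key s hst]
      have h1 := H (x := s) ⟨hsT, hst, hsT2⟩ (by rw [Real.dist_eq]; exact hd)
      rw [Real.dist_eq] at h1
      exact mul_le_mul_of_nonneg_right h1.le (hP s hst).le
end
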